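/- arXiv:1302.5387 — 3 statements merged into one kernel-verified Lean document; each statement's English description precedes it below -/
import Mathlib

section
/- For every integer N ≥ 3 there exists a constant C(N) > 0 such that for every natural number D, the double series satisfies Σ_{n=0}^∞ Σ_{k=0}^{D} 1/((1+k+n)^N (1+D+n−k)^N) ≤ C(N)/(1+D)^N. -/
theorem one_div_pow_mul_pow_le {a b s : ℝ} (ha : 0 < a) (hb : 0 < b) (hs : 0 < s)
    (h : s ≤ a + b) (N : ℕ) :
    1 / (a ^ N * b ^ N) ≤ 2 ^ N / s ^ N * (1 / a ^ N + 1 / b ^ N) := by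
  wlog hab : a ≤ b generalizing a b
  · have := this hb ha (by linarith) (le_of_not_ge hab)
    rwa [mul_comm (b ^ N), add_comm (1 / b ^ N)] at this
  have hsb : 1 / b ^ N ≤ 2 ^ N / s ^ N := by
    rw [← div_pow, ← one_div_pow]
    refine pow_le_pow_left₀ (by positivity) ?_ N
    rw [div_le_div_iff₀ hb hs]
    linarith
  calc 1 / (a ^ N * b ^ N) = 1 / b ^ N * (1 / a ^ N) := by
        rw [one_div_mul_one_div, mul_comm]
    _ ≤ 2 ^ N / s ^ N * (1 / a ^ N) := by gcongr
    _ ≤ 2 ^ N / s ^ N * (1 / a ^ N + 1 / b ^ N) := by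
        gcongr
        exact le_add_of_nonneg_right (by positivity)

theorem summable_one_div_one_add_rpow {p : ℝ} (hp : 1 < p) :
    Summable fun n : ℕ => 1 / (1 + (n : ℝ)) ^ p := by
  have := (summable_nat_add_iff 1).2 (Real.summable_one_div_nat_rpow.2 hp)
  simpa [add_comm] using this

theorem one_div_one_add_add_pow_le {N : ℕ} (hN : 3 ≤ N) (k n : ℕ) :
    1 / (1 + (k : ℝ) + n) ^ N ≤
      1 / (1 + (k : ℝ)) ^ (3 / 2 : ℝ) * (1 / (1 + (n : ℝ)) ^ (3 / 2 : ℝ)) := by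
  have hk : (0 : ℝ) ≤ k := k.cast_nonneg
  have hn : (0 : ℝ) ≤ n := n.cast_nonneg
  rw [one_div_mul_one_div, ← Real.mul_rpow (by positivity) (by positivity)]
  refine one_div_le_one_div_of_le (by positivity) ?_
  calc ((1 + (k : ℝ)) * (1 + n)) ^ (3 / 2 : ℝ)
      ≤ ((1 + (k : ℝ) + n) ^ (2 : ℝ)) ^ (3 / 2 : ℝ) := by
        refine Real.rpow_le_rpow (by positivity) ?_ (by norm_num)
        rw [Real.rpow_two]
        nlinarith [mul_nonneg hk hn]
    _ = (1 + (k : ℝ) + n) ^ 3 := by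
        rw [← Real.rpow_mul (by positivity), ← Real.rpow_natCast]
        norm_num
    _ ≤ (1 + (k : ℝ) + n) ^ N := pow_le_pow_right₀ (by linarith) hN

theorem sum_range_one_div_one_add_add_pow_le {N : ℕ} (hN : 3 ≤ N) (m n : ℕ) :
    ∑ k ∈ Finset.range m, 1 / (1 + (k : ℝ) + n) ^ N ≤
      (∑' k : ℕ, 1 / (1 + (k : ℝ)) ^ (3 / 2 : ℝ)) * (1 / (1 + (n : ℝ)) ^ (3 / 2 : ℝ)) := by
  refine (Finset.sum_le_sum fun k _ => one_div_one_add_add_pow_le hN k n).trans ?_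
  rw [← Finset.sum_mul]
  gcongr
  exact (summable_one_div_one_add_rpow (by norm_num)).sum_le_tsum _ fun _ _ => by positivity

theorem sum_range_one_div_mul_le {N : ℕ} (hN : 3 ≤ N) (D n : ℕ) :
    ∑ k ∈ Finset.range (D + 1),
        (1 : ℝ) / ((1 + (k : ℝ) + (n : ℝ)) ^ N * (1 + (D : ℝ) + (n : ℝ) - (k : ℝ)) ^ N) ≤
      2 ^ N / (1 + (D : ℝ)) ^ N * (2 * ∑' k : ℕ, 1 / (1 + (k : ℝ)) ^ (3 / 2 : ℝ)) *
        (1 / (1 + (n : ℝ)) ^ (3 / 2 : ℝ)) := by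
  have hreflect : ∑ k ∈ Finset.range (D + 1), 1 / (1 + (D : ℝ) + n - k) ^ N =
      ∑ k ∈ Finset.range (D + 1), 1 / (1 + (k : ℝ) + n) ^ N := by
    rw [← Finset.sum_range_reflect]
    refine Finset.sum_congr rfl fun k hk => ?_
    have hkD : k ≤ D := Nat.lt_succ_iff.1 (Finset.mem_range.1 hk)
    rw [Nat.add_sub_cancel, Nat.cast_sub hkD]
    congr 2
    ring
  have hsum := sum_range_one_div_one_add_add_pow_le hN (D + 1) n
  calc _ ≤ ∑ k ∈ Finset.range (D + 1), 2 ^ N / (1 + (D : ℝ)) ^ N *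
          (1 / (1 + (k : ℝ) + n) ^ N + 1 / (1 + (D : ℝ) + n - k) ^ N) := by
        refine Finset.sum_le_sum fun k hk => ?_
        have hkD : (k : ℝ) ≤ D := by
          exact_mod_cast Nat.lt_succ_iff.1 (Finset.mem_range.1 hk)
        have hn : (0 : ℝ) ≤ n := n.cast_nonneg
        exact one_div_pow_mul_pow_le (by positivity) (by linarith) (by positivity)
          (by linarith) N
    _ = 2 ^ N / (1 + (D : ℝ)) ^ N *
          (2 * ∑ k ∈ Finset.range (D + 1), 1 / (1 + (k : ℝ) + n) ^ N) := by
        rw [← Finset.mul_sum, Finset.sum_add_distrib, hreflect, two_mul]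
    _ ≤ _ := by
        rw [mul_assoc, mul_assoc]
        gcongr

/-- For every integer `N ≥ 3` there exists `C = C(N) > 0` such that for every `D : ℕ`,
the double series `∑_{n≥0} ∑_{k=0}^{D} 1/((1+k+n)^N (1+D+n-k)^N)` converges and is
bounded by `C/(1+D)^N`. -/
theorem double_series_bound (N : ℕ) (hN : 3 ≤ N) :
    ∃ C : ℝ, 0 < C ∧ ∀ D : ℕ,
      Summable (fun n : ℕ => ∑ k ∈ Finset.range (D + 1),
        (1 : ℝ) / ((1 + (k : ℝ) + (n : ℝ)) ^ N * (1 + (D : ℝ) + (n : ℝ) - (k : ℝ)) ^ N)) ∧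
      (∑' n : ℕ, ∑ k ∈ Finset.range (D + 1),
        (1 : ℝ) / ((1 + (k : ℝ) + (n : ℝ)) ^ N * (1 + (D : ℝ) + (n : ℝ) - (k : ℝ)) ^ N)) ≤
        C / (1 + (D : ℝ)) ^ N := by
  have hu := summable_one_div_one_add_rpow (p := 3 / 2) (by norm_num)
  set S := ∑' k : ℕ, 1 / (1 + (k : ℝ)) ^ (3 / 2 : ℝ) with hS
  have hSpos : 0 < S := hu.tsum_pos (fun _ => by positivity) 0 (by positivity)
  refine ⟨2 ^ N * (2 * S) * S, by positivity, fun D => ?_⟩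
  have hle := sum_range_one_div_mul_le hN D
  have hbound := hu.mul_left (2 ^ N / (1 + (D : ℝ)) ^ N * (2 * S))
  have hsummable := Summable.of_nonneg_of_le (fun n => Finset.sum_nonneg fun k hk => by
    have hkD : (k : ℝ) ≤ D := by
      exact_mod_cast Nat.lt_succ_iff.1 (Finset.mem_range.1 hk)
    have hb : 0 < 1 + (D : ℝ) + (n : ℝ) - (k : ℝ) := by
      have hn : (0 : ℝ) ≤ n := n.cast_nonneg
      linarith
    positivity) hle hbound
  refine ⟨hsummable, (hsummable.tsum_le_tsum hle hbound).trans_eq ?_⟩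
  rw [tsum_mul_left, ← hS]
  ring
end

section
/- Let q ≥ 2 be an integer and let G be a (q+1)-regular tree. For every integer N ≥ 3 there exists a constant C(N) > 0 (depending only on N) with the following property: for all constants C_A, C_B ≥ 0 and all kernels K_A, K_B : V × V → ℂ satisfying |K_A(x,y)| ≤ C_A · q^{−d(x,y)/2}/(1+d(x,y))^N and |K_B(x,y)| ≤ C_B · q^{−d(x,y)/2}/(1+d(x,y))^N for all x, y ∈ V, one has for all x, y ∈ V: Σ_{z ∈ V} |K_A(x,z)|·|K_B(z,y)| ≤ C(N)·C_A·C_B · q^{−d(x,y)/2}/(1+d(x,y))^N (in particular the sum over z converges). -/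
namespace SimpleGraph

variable {V : Type*} {G : SimpleGraph V}

/-- Two paths that meet only at their common endpoint concatenate to a path. -/
theorem Walk.IsPath.append_of_support_inter {u v w : V} {p : G.Walk u v} {r : G.Walk v w}
    (hp : p.IsPath) (hr : r.IsPath) (h : ∀ a ∈ p.support, a ∈ r.support → a = v) :
    (p.append r).IsPath := by
  rw [Walk.isPath_def] at hp hr ⊢
  rw [← Walk.cons_tail_support, List.nodup_cons] at hr
  rw [Walk.support_append, List.nodup_append']
  refine ⟨hp, hr.2, fun a ha ha' => ?_⟩
  obtain rfl := h a ha (List.mem_of_mem_tail ha')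
  exact hr.1 ha'

theorem IsTree.dist_eq_length_of_isPath (hG : G.IsTree) {u v : V} {p : G.Walk u v}
    (hp : p.IsPath) : G.dist u v = p.length := by
  obtain ⟨r, hr, hlen⟩ := hG.connected.exists_path_of_dist u v
  have : (⟨p, hp⟩ : G.Path u v) = ⟨r, hr⟩ := (hG.isAcyclic.subsingleton_path u v).elim _ _
  rw [← hlen, congrArg (fun s : G.Path u v => s.1.length) this]

/-- Every vertex `z` of a tree projects onto a given path: its geodesics to the endpoints pass
through a common vertex of the path. -/
theorem IsTree.exists_projection (hG : G.IsTree) {x y : V} {p : G.Walk x y} (hp : p.IsPath)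
    (z : V) : ∃ j ≤ p.length, G.dist x z = j + G.dist (p.getVert j) z ∧
      G.dist z y = G.dist (p.getVert j) z + (p.length - j) := by
  obtain ⟨j, hj, hmin⟩ := Finset.exists_min_image (Finset.range (p.length + 1))
    (fun i => G.dist z (p.getVert i)) ⟨0, by simp⟩
  have hj' : j ≤ p.length := by simpa [Nat.lt_succ_iff] using hj
  obtain ⟨w, hw, hlen⟩ := hG.connected.exists_path_of_dist z (p.getVert j)
  have hmeet : ∀ a ∈ w.support, a ∈ p.support → a = p.getVert j := by
    classical
    intro a ha hap
    obtain ⟨i, rfl, hi⟩ := Walk.mem_support_iff_exists_getVert.mp hap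
    have hle := hmin i (by simpa [Nat.lt_succ_iff] using hi)
    have hsplit := congrArg Walk.length (w.take_spec ha)
    rw [Walk.length_append] at hsplit
    have hz := dist_le (w.takeUntil _ ha)
    exact Walk.eq_of_length_eq_zero (p := w.dropUntil _ ha) (by omega)
  refine ⟨j, hj', ?_, ?_⟩
  · have hpath := hw.append_of_support_inter (hp.take j).reverse fun a ha ha' =>
      hmeet a ha ((p.isSubwalk_take j).support_subset (by simpa using ha'))
    rw [dist_comm, hG.dist_eq_length_of_isPath hpath, Walk.length_append, Walk.length_reverse,
      Walk.take_length, hlen, dist_comm]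
    omega
  · have hpath := hw.append_of_support_inter (hp.drop j) fun a ha ha' =>
      hmeet a ha ((p.isSubwalk_drop j).support_subset ha')
    rw [hG.dist_eq_length_of_isPath hpath, Walk.length_append, Walk.drop_length, hlen, dist_comm]

/-- A vertex at positive distance from `v` has a neighbour closer to `v`. -/
theorem Connected.exists_adj_dist_eq (hG : G.Connected) {v u : V} {k : ℕ}
    (h : G.dist v u = k + 1) : ∃ t, G.Adj u t ∧ G.dist v t = k := by
  obtain ⟨p, hp⟩ := hG.exists_walk_length_eq_dist u v
  cases p with
  | nil => simp at h
  | @cons _ t _ hadj r =>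
    rw [dist_comm, h, Walk.length_cons] at hp
    refine ⟨t, hadj, ?_⟩
    have h₁ := dist_le r
    have h₂ := hG.dist_triangle (u := v) (v := t) (w := u)
    rw [dist_eq_one_iff_adj.mpr hadj.symm] at h₂
    rw [dist_comm] at h₁
    omega

/-- A sphere of radius `k + 1` in a connected graph of degree `q + 1` has at most
`(q + 1) * q ^ k` vertices. -/
theorem Connected.sphere_finite_and_ncard_le (hG : G.Connected) {q : ℕ}
    (hdeg : ∀ v, (G.neighborSet v).ncard = q + 1) (v : V) (k : ℕ) :
    {z | G.dist v z = k + 1}.Finite ∧ {z | G.dist v z = k + 1}.ncard ≤ (q + 1) * q ^ k := by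
  have hfin : ∀ v, (G.neighborSet v).Finite := fun v =>
    Set.finite_of_ncard_ne_zero (by rw [hdeg]; omega)
  induction k with
  | zero =>
    have : {z | G.dist v z = 0 + 1} = G.neighborSet v := by
      ext z
      simp
    rw [this]
    exact ⟨hfin v, by simp [hdeg]⟩
  | succ k ih =>
    classical
    obtain ⟨hS, hcard⟩ := ih
    let f : V → Finset V := fun u => (hfin u).toFinset.filter fun z => G.dist v z = k + 1 + 1
    have hsub : {z | G.dist v z = k + 1 + 1} ⊆ (hS.toFinset.biUnion f : Finset V) := by
      intro z hz
      obtain ⟨u, hu, hd⟩ := hG.exists_adj_dist_eq hz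
      simp only [Finset.coe_biUnion, Set.mem_iUnion]
      refine ⟨u, by simpa using hd, ?_⟩
      simpa [f] using ⟨hu.symm, hz⟩
    have hf : ∀ u ∈ hS.toFinset, (f u).card ≤ q := by
      intro u hu
      obtain ⟨t, ht, hd⟩ := hG.exists_adj_dist_eq (v := v) (u := u) (k := k) (by simpa using hu)
      have hlt : (f u).card < (hfin u).toFinset.card := by
        refine Finset.card_lt_card ((Finset.filter_ssubset).mpr ⟨t, by simpa using ht, ?_⟩)
        omega
      rw [← Set.ncard_eq_toFinset_card _ (hfin u), hdeg] at hlt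
      omega
    refine ⟨(Finset.finite_toSet _).subset hsub, ?_⟩
    calc _ ≤ (hS.toFinset.biUnion f).card := by
          rw [← Set.ncard_coe_finset]
          exact Set.ncard_le_ncard hsub (Finset.finite_toSet _)
      _ ≤ hS.toFinset.card * q := Finset.card_biUnion_le_card_mul _ _ _ hf
      _ ≤ (q + 1) * q ^ k * q := by
          rw [← Set.ncard_eq_toFinset_card _ hS]
          exact Nat.mul_le_mul_right _ hcard
      _ = _ := by ring

theorem Connected.card_filter_dist_le (hG : G.Connected) {q : ℕ} (hq : 1 ≤ q)
    (hdeg : ∀ v, (G.neighborSet v).ncard = q + 1) (v : V) (T : Finset V) (h : ℕ) :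
    (T.filter fun z => G.dist v z = h).card ≤ 2 * q ^ h := by
  cases h with
  | zero =>
    have : (T.filter fun z => G.dist v z = 0).card ≤ 1 := by
      refine Finset.card_le_one.mpr fun a ha b hb => ?_
      simp only [Finset.mem_filter, hG.dist_eq_zero_iff] at ha hb
      rw [← ha.2, ← hb.2]
    rw [pow_zero]
    omega
  | succ k =>
    obtain ⟨hS, hcard⟩ := hG.sphere_finite_and_ncard_le hdeg v k
    calc _ ≤ {z | G.dist v z = k + 1}.ncard := by
          rw [← Set.ncard_coe_finset]
          exact Set.ncard_le_ncard (fun z hz => by simpa using (Finset.mem_filter.mp hz).2) hS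
      _ ≤ (q + 1) * q ^ k := hcard
      _ ≤ (2 * q) * q ^ k := Nat.mul_le_mul_right _ (by omega)
      _ = _ := by ring

/-- A radial weight, normalized by the exponential growth of spheres, sums over any finite set
of vertices to at most twice its sum over the radii. -/
theorem Connected.sum_radial_le (hG : G.Connected) {q : ℕ} (hq : 1 ≤ q)
    (hdeg : ∀ v, (G.neighborSet v).ncard = q + 1) {a : ℕ → ℝ} (ha : ∀ k, 0 ≤ a k)
    (hsum : Summable a) (v : V) (T : Finset V) :
    ∑ z ∈ T, ((q : ℝ) ^ G.dist v z)⁻¹ * a (G.dist v z) ≤ 2 * ∑' k, a k := by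
  classical
  have hq0 : (0 : ℝ) < q := by exact_mod_cast hq
  rw [Finset.sum_comp (fun h : ℕ => ((q : ℝ) ^ h)⁻¹ * a h) (fun z => G.dist v z)]
  calc _ ≤ ∑ h ∈ T.image (fun z => G.dist v z), 2 * a h := by
        refine Finset.sum_le_sum fun h _ => ?_
        have hc : ((T.filter fun z => G.dist v z = h).card : ℝ) ≤ 2 * (q : ℝ) ^ h := by
          exact_mod_cast hG.card_filter_dist_le hq hdeg v T h
        rw [nsmul_eq_mul]
        calc _ ≤ 2 * (q : ℝ) ^ h * (((q : ℝ) ^ h)⁻¹ * a h) :=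
              mul_le_mul_of_nonneg_right hc (mul_nonneg (by positivity) (ha h))
          _ = 2 * a h := by field_simp
    _ ≤ _ := by
        rw [← Finset.mul_sum]
        gcongr
        exact hsum.sum_le_tsum _ fun k _ => ha k

end SimpleGraph

theorem inv_one_add_add_pow_le {N : ℕ} (hN : 3 ≤ N) (j h : ℕ) :
    ((1 + ((j : ℝ) + h)) ^ N)⁻¹ ≤
      ((1 + (j : ℝ)) ^ (3 / 2 : ℝ))⁻¹ * ((1 + (h : ℝ)) ^ (3 / 2 : ℝ))⁻¹ := by
  have hj : (0 : ℝ) ≤ j := j.cast_nonneg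
  have hh : (0 : ℝ) ≤ h := h.cast_nonneg
  rw [← mul_inv, ← Real.mul_rpow (by positivity) (by positivity)]
  refine inv_anti₀ (by positivity) ?_
  calc ((1 + (j : ℝ)) * (1 + h)) ^ (3 / 2 : ℝ)
      ≤ ((1 + ((j : ℝ) + h)) ^ 2) ^ (3 / 2 : ℝ) :=
        Real.rpow_le_rpow (by positivity) (by nlinarith) (by norm_num)
    _ = (1 + ((j : ℝ) + h)) ^ 3 := by
        rw [← Real.rpow_natCast, ← Real.rpow_mul (by positivity), ← Real.rpow_natCast]
        norm_num
    _ ≤ _ := pow_le_pow_right₀ (by linarith) hN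

/-- If `A + B ≥ M`, then one of `A`, `B` is at least `M / 2`. -/
theorem inv_pow_mul_inv_pow_le {A B M : ℝ} (hA : 0 < A) (hB : 0 < B) (hM : 0 < M)
    (h : M ≤ A + B) (N : ℕ) :
    (A ^ N)⁻¹ * (B ^ N)⁻¹ ≤ 2 ^ N / M ^ N * ((A ^ N)⁻¹ + (B ^ N)⁻¹) := by
  have key : ∀ X : ℝ, M / 2 ≤ X → (X ^ N)⁻¹ ≤ 2 ^ N / M ^ N := by
    intro X hX
    rw [← div_pow, ← inv_div (M : ℝ) 2, inv_pow]
    exact inv_anti₀ (by positivity) (by gcongr)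
  have hA' : 0 < (A ^ N)⁻¹ := by positivity
  have hB' : 0 < (B ^ N)⁻¹ := by positivity
  have hD : 0 < 2 ^ N / M ^ N := by positivity
  rcases le_total A B with hAB | hAB
  · have := key B (by linarith)
    nlinarith [mul_pos hD hB']
  · have := key A (by linarith)
    nlinarith [mul_pos hD hA']

theorem summable_inv_one_add_rpow_three_halves :
    Summable fun k : ℕ => ((1 + (k : ℝ)) ^ (3 / 2 : ℝ))⁻¹ := by
  have h := (summable_nat_add_iff 1).mpr
    (Real.summable_nat_rpow_inv.mpr (by norm_num : (1 : ℝ) < 3 / 2))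
  refine h.congr fun k => ?_
  rw [Nat.cast_add, Nat.cast_one, add_comm]

/-- Pointwise bound on the product of two weights in terms of the projection, at height `h` over
position `j`, onto a geodesic of length `n`. -/
theorem weight_mul_weight_le {N : ℕ} (hN : 3 ≤ N) {q : ℝ} (hq : 0 < q) {n j h a b : ℕ}
    (hj : j ≤ n) (ha : a = j + h) (hb : b = h + (n - j)) :
    (q ^ (-(a : ℝ) / 2) / (1 + (a : ℝ)) ^ N) * (q ^ (-(b : ℝ) / 2) / (1 + (b : ℝ)) ^ N) ≤
      2 ^ N * (q ^ (-(n : ℝ) / 2) / (1 + (n : ℝ)) ^ N) *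
        ((((1 + (j : ℝ)) ^ (3 / 2 : ℝ))⁻¹ + ((1 + ((n - j : ℕ) : ℝ)) ^ (3 / 2 : ℝ))⁻¹) *
          ((q ^ h)⁻¹ * ((1 + (h : ℝ)) ^ (3 / 2 : ℝ))⁻¹)) := by
  have hpow : q ^ (-(a : ℝ) / 2) * q ^ (-(b : ℝ) / 2) = q ^ (-(n : ℝ) / 2) * (q ^ h)⁻¹ := by
    rw [← Real.rpow_natCast q h, ← Real.rpow_neg hq.le, ← Real.rpow_add hq, ← Real.rpow_add hq,
      ha, hb]
    congr 1
    push_cast [hj]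
    ring
  have hab : (1 : ℝ) + n ≤ (1 + a) + (1 + b) := by
    have : n ≤ a + b := by omega
    have : (n : ℝ) ≤ a + b := by exact_mod_cast this
    linarith
  have h₁ := inv_pow_mul_inv_pow_le (A := 1 + (a : ℝ)) (B := 1 + (b : ℝ)) (M := 1 + (n : ℝ))
    (by positivity) (by positivity) (by positivity) hab N
  have h₂ := inv_one_add_add_pow_le hN j h
  have h₃ := inv_one_add_add_pow_le hN (n - j) h
  have ha' : (a : ℝ) = j + h := by exact_mod_cast ha
  have hb' : (b : ℝ) = (n - j : ℕ) + h := by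
    rw [add_comm]
    exact_mod_cast hb
  rw [← ha'] at h₂
  rw [← hb'] at h₃
  calc _ = (q ^ (-(a : ℝ) / 2) * q ^ (-(b : ℝ) / 2)) *
        (((1 + (a : ℝ)) ^ N)⁻¹ * ((1 + (b : ℝ)) ^ N)⁻¹) := by ring
    _ ≤ (q ^ (-(n : ℝ) / 2) * (q ^ h)⁻¹) * (2 ^ N / (1 + (n : ℝ)) ^ N *
        (((1 + (j : ℝ)) ^ (3 / 2 : ℝ))⁻¹ * ((1 + (h : ℝ)) ^ (3 / 2 : ℝ))⁻¹ +
          ((1 + ((n - j : ℕ) : ℝ)) ^ (3 / 2 : ℝ))⁻¹ * ((1 + (h : ℝ)) ^ (3 / 2 : ℝ))⁻¹)) := by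
        rw [hpow]
        exact mul_le_mul_of_nonneg_left (h₁.trans (by gcongr)) (by positivity)
    _ = _ := by ring

/-- The convolution of two weights over a finite set of vertices of a regular tree. -/
theorem SimpleGraph.IsTree.sum_weight_mul_weight_le {V : Type*} {G : SimpleGraph V}
    (hG : G.IsTree) {N : ℕ} (hN : 3 ≤ N) {q : ℕ} (hq : 1 ≤ q)
    (hdeg : ∀ v, (G.neighborSet v).ncard = q + 1) (x y : V) (T : Finset V) :
    ∑ z ∈ T, ((q : ℝ) ^ (-(G.dist x z : ℝ) / 2) / (1 + (G.dist x z : ℝ)) ^ N) *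
        ((q : ℝ) ^ (-(G.dist z y : ℝ) / 2) / (1 + (G.dist z y : ℝ)) ^ N) ≤
      2 ^ N * 4 * (∑' k : ℕ, ((1 + (k : ℝ)) ^ (3 / 2 : ℝ))⁻¹) ^ 2 *
        ((q : ℝ) ^ (-(G.dist x y : ℝ) / 2) / (1 + (G.dist x y : ℝ)) ^ N) := by
  have hq0 : (0 : ℝ) < q := by exact_mod_cast hq
  obtain ⟨p, hp, hlen⟩ := hG.connected.exists_path_of_dist x y
  set n := G.dist x y
  let c : ℕ → ℝ := fun k => ((1 + (k : ℝ)) ^ (3 / 2 : ℝ))⁻¹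
  have hc : ∀ k, 0 ≤ c k := fun k => by positivity
  have hsum : Summable c := summable_inv_one_add_rpow_three_halves
  let D : ℝ := 2 ^ N * ((q : ℝ) ^ (-(n : ℝ) / 2) / (1 + (n : ℝ)) ^ N)
  have hD : 0 ≤ D := by positivity
  have hS : 0 ≤ ∑' k, c k := tsum_nonneg hc
  let W : ℕ → V → ℝ := fun j z =>
    ((q : ℝ) ^ G.dist (p.getVert j) z)⁻¹ * c (G.dist (p.getVert j) z)
  have hW : ∀ j z, 0 ≤ W j z := fun j z => mul_nonneg (by positivity) (hc _)
  have hpoint : ∀ z, ((q : ℝ) ^ (-(G.dist x z : ℝ) / 2) / (1 + (G.dist x z : ℝ)) ^ N) *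
        ((q : ℝ) ^ (-(G.dist z y : ℝ) / 2) / (1 + (G.dist z y : ℝ)) ^ N) ≤
      ∑ j ∈ Finset.range (n + 1), D * ((c j + c (n - j)) * W j z) := by
    intro z
    obtain ⟨j, hj, hx, hy⟩ := hG.exists_projection hp z
    rw [hlen] at hj hy
    refine (weight_mul_weight_le hN hq0 hj hx hy).trans ?_
    exact Finset.single_le_sum (f := fun j => D * ((c j + c (n - j)) * W j z))
      (fun i _ => mul_nonneg hD (mul_nonneg (add_nonneg (hc _) (hc _)) (hW _ _)))
      (Finset.mem_range.mpr (Nat.lt_succ_of_le hj))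
  have hle : ∑ j ∈ Finset.range (n + 1), c j ≤ ∑' k, c k := hsum.sum_le_tsum _ fun k _ => hc k
  have hreflect : ∑ j ∈ Finset.range (n + 1), c (n - j) = ∑ j ∈ Finset.range (n + 1), c j := by
    simpa using Finset.sum_range_reflect c (n + 1)
  calc _ ≤ ∑ z ∈ T, ∑ j ∈ Finset.range (n + 1), D * ((c j + c (n - j)) * W j z) :=
        Finset.sum_le_sum fun z _ => hpoint z
    _ = ∑ j ∈ Finset.range (n + 1), D * ((c j + c (n - j)) * ∑ z ∈ T, W j z) := by
        rw [Finset.sum_comm]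
        simp only [Finset.mul_sum]
    _ ≤ ∑ j ∈ Finset.range (n + 1), D * ((c j + c (n - j)) * (2 * ∑' k, c k)) := by
        refine Finset.sum_le_sum fun j _ => mul_le_mul_of_nonneg_left
          (mul_le_mul_of_nonneg_left ?_ (add_nonneg (hc _) (hc _))) hD
        exact hG.connected.sum_radial_le hq hdeg hc hsum _ T
    _ = D * (2 * ∑ j ∈ Finset.range (n + 1), c j) * (2 * ∑' k, c k) := by
        rw [two_mul (∑ j ∈ Finset.range (n + 1), c j)]
        nth_rewrite 2 [← hreflect]
        rw [← Finset.sum_add_distrib, Finset.mul_sum, Finset.sum_mul]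
        exact Finset.sum_congr rfl fun j _ => by ring
    _ ≤ D * (2 * ∑' k, c k) * (2 * ∑' k, c k) := by gcongr
    _ = _ := by
        simp only [D, c]
        ring


/-- For every `N ≥ 3` there is a constant `C(N) > 0`, depending only on `N`, such that
on any `(q+1)`-regular tree, if two kernels `K_A, K_B` satisfy
`|K(x,y)| ≤ C_• · q^{−d(x,y)/2}/(1+d(x,y))^N`, then the kernel of the composition
satisfies the same kind of bound with constant `C(N)·C_A·C_B`. -/
theorem kernel_product_decay (N : ℕ) (hN : 3 ≤ N) :
    ∃ C : ℝ, 0 < C ∧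
      ∀ (q : ℕ), 2 ≤ q → ∀ (V : Type) (G : SimpleGraph V), G.IsTree →
        (∀ v : V, (G.neighborSet v).ncard = q + 1) →
        ∀ (CA CB : ℝ), 0 ≤ CA → 0 ≤ CB → ∀ (KA KB : V → V → ℂ),
        (∀ x y : V, ‖KA x y‖ ≤
          CA * (q : ℝ) ^ (-(G.dist x y : ℝ) / 2) / (1 + (G.dist x y : ℝ)) ^ N) →
        (∀ x y : V, ‖KB x y‖ ≤
          CB * (q : ℝ) ^ (-(G.dist x y : ℝ) / 2) / (1 + (G.dist x y : ℝ)) ^ N) →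
        ∀ x y : V,
          Summable (fun z : V => ‖KA x z‖ * ‖KB z y‖) ∧
          (∑' z : V, ‖KA x z‖ * ‖KB z y‖) ≤
            C * CA * CB * (q : ℝ) ^ (-(G.dist x y : ℝ) / 2) / (1 + (G.dist x y : ℝ)) ^ N := by
  have hpos : 0 < ∑' k : ℕ, ((1 + (k : ℝ)) ^ (3 / 2 : ℝ))⁻¹ :=
    summable_inv_one_add_rpow_three_halves.tsum_pos (fun k => by positivity) 0 (by positivity)
  refine ⟨2 ^ N * 4 * (∑' k : ℕ, ((1 + (k : ℝ)) ^ (3 / 2 : ℝ))⁻¹) ^ 2, by positivity, ?_⟩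
  intro q hq V G hG hdeg CA CB hCA hCB KA KB hA hB x y
  have hbound : ∀ T : Finset V, ∑ z ∈ T, ‖KA x z‖ * ‖KB z y‖ ≤
      2 ^ N * 4 * (∑' k : ℕ, ((1 + (k : ℝ)) ^ (3 / 2 : ℝ))⁻¹) ^ 2 * CA * CB *
        (q : ℝ) ^ (-(G.dist x y : ℝ) / 2) / (1 + (G.dist x y : ℝ)) ^ N := by
    intro T
    calc _ ≤ ∑ z ∈ T, CA * CB *
          (((q : ℝ) ^ (-(G.dist x z : ℝ) / 2) / (1 + (G.dist x z : ℝ)) ^ N) *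
          ((q : ℝ) ^ (-(G.dist z y : ℝ) / 2) / (1 + (G.dist z y : ℝ)) ^ N)) := by
          refine Finset.sum_le_sum fun z _ => ?_
          refine (mul_le_mul (hA x z) (hB z y) (norm_nonneg _) (by positivity)).trans_eq ?_
          ring
      _ ≤ _ := by
          rw [← Finset.mul_sum]
          refine (mul_le_mul_of_nonneg_left (hG.sum_weight_mul_weight_le hN (by omega) hdeg x y T)
            (mul_nonneg hCA hCB)).trans_eq ?_
          ring
  exact ⟨summable_of_sum_le (fun z => by positivity) hbound,
    Real.tsum_le_of_sum_le (fun z => by positivity) hbound⟩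
end

section
/- Let q ≥ 2 be an integer. Define, for s ∈ ℝ with sin(s·log q) ≠ 0, c(s) = (√q/(q+1)) · (q^{1/2}·e^{i s log q} − q^{−1/2}·e^{−i s log q})/(e^{i s log q} − e^{−i s log q}) and p(s) = ((q+1)²/q) · 4 sin²(s·log q)/(q + q^{−1} − 2 cos(2 s log q)). Then there exists an infinitely differentiable function g : ℝ → ℂ such that g(s) = c(s)·p(s) for every s ∈ ℝ with sin(s·log q) ≠ 0; that is, the poles of c(s) are compensated by the factor p(s) = |c(s)|^{−2} and s ↦ c(s)|c(s)|^{−2} extends to a C^∞ function on ℝ. -/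
/-- The Plancherel denominator `x + x⁻¹ - 2 cos θ` is positive for `x > 1`. -/
theorem add_inv_sub_two_mul_cos_pos {x : ℝ} (hx : 1 < x) (θ : ℝ) :
    0 < x + x⁻¹ - 2 * Real.cos θ := by
  have h0 : 0 < x := by linarith
  have h : x + x⁻¹ - 2 = (x - 1) ^ 2 / x := by field_simp; ring
  have h' : 0 < (x - 1) ^ 2 / x := div_pos (pow_pos (by linarith) 2) h0
  linarith [Real.cos_le_one θ]

theorem exp_I_mul_sub_exp_neg_I_mul (z : ℂ) :
    Complex.exp (Complex.I * z) - Complex.exp (-(Complex.I * z)) =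
      2 * Complex.I * Complex.sin z := by
  rw [mul_right_comm, Complex.two_sin, mul_assoc, Complex.I_mul_I, neg_mul,
    mul_comm Complex.I z]
  ring

/-- The map `s ↦ c(s)·|c(s)|⁻²`, where `c` is the Harish-Chandra c-function of the
`(q+1)`-homogeneous tree, extends to a `C^∞` function on `ℝ`: the poles of `c(s)` are
compensated by the factor `p(s) = |c(s)|⁻²`. -/
theorem c_function_times_plancherel_smooth (q : ℕ) (hq : 2 ≤ q) :
    ∃ g : ℝ → ℂ, ContDiff ℝ (⊤ : ℕ∞) g ∧
      ∀ s : ℝ, Real.sin (s * Real.log q) ≠ 0 →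
        g s =
          (((Real.sqrt q / (q + 1) : ℝ)) : ℂ) *
            ((Real.sqrt q * Complex.exp (Complex.I * (s * Real.log q)) -
                (Real.sqrt q)⁻¹ * Complex.exp (-(Complex.I * (s * Real.log q)))) /
              (Complex.exp (Complex.I * (s * Real.log q)) -
                Complex.exp (-(Complex.I * (s * Real.log q))))) *
          ((((q + 1 : ℝ) ^ 2 / q) *
            (4 * Real.sin (s * Real.log q) ^ 2 /
              ((q : ℝ) + (q : ℝ)⁻¹ - 2 * Real.cos (2 * (s * Real.log q)))) : ℝ) : ℂ) := by
  have hq1 : (1 : ℝ) < q := by exact_mod_cast hq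
  refine ⟨fun s => (((Real.sqrt q / (q + 1) : ℝ)) : ℂ) *
      ((Real.sqrt q * Complex.exp (Complex.I * (s * Real.log q)) -
        (Real.sqrt q)⁻¹ * Complex.exp (-(Complex.I * (s * Real.log q)))) *
          (-2 * Complex.I)) *
      ((((q + 1 : ℝ) ^ 2 / q) * (Real.sin (s * Real.log q) /
        ((q : ℝ) + (q : ℝ)⁻¹ - 2 * Real.cos (2 * (s * Real.log q)))) : ℝ) : ℂ), ?_, ?_⟩
  · have hofReal : ContDiff ℝ (⊤ : ℕ∞) (fun s : ℝ => (s : ℂ)) := Complex.ofRealCLM.contDiff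
    refine ContDiff.mul (by fun_prop) (hofReal.comp (contDiff_const.mul (ContDiff.div ?_ ?_ ?_)))
    · fun_prop
    · fun_prop
    · exact fun s => (add_inv_sub_two_mul_cos_pos hq1 _).ne'
  · intro s hs
    have hs' : Complex.sin (s * Real.log q) ≠ 0 := by exact_mod_cast hs
    rw [exp_I_mul_sub_exp_neg_I_mul]
    have hI : (-2 * Complex.I) * (2 * Complex.I) = 4 := by
      linear_combination -4 * Complex.I_mul_I
    rw [eq_comm, mul_div_assoc', div_mul_eq_mul_div,
      div_eq_iff (mul_ne_zero (mul_ne_zero two_ne_zero Complex.I_ne_zero) hs')]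
    push_cast
    rw [← hI]
    ring
end
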